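/- (Corollary 1.) Under a matching preserving a two-dimensional conformal group as in Theorem 1, if the G₂ acts orthogonally transitively on one side, i.e. (ξ⁺∧η⁺∧dη⁺) = (ξ⁺∧η⁺∧dξ⁺) = 0 on W⁺, then the corresponding forms for the generators on the other side vanish on the matching hypersurface: (ξ⁻∧η⁻∧dη⁻)|_Σ = 0 and (ξ⁻∧η⁻∧dξ⁻)|_Σ = 0. -/

import Mathlib

/-!
Coordinate (local-chart) formalization of pseudo-Riemannian geometry on `ℝⁿ`:
manifolds are modeled by `Pt n = Fin n → ℝ`, tensor fields by their component
functions, and all differential-geometric operations (Lie derivatives, the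
Levi-Civita connection via Christoffel symbols, curvature, pullbacks along
embeddings, exterior derivatives and wedge products) are defined explicitly.
-/

noncomputable section
open scoped BigOperators

abbrev Pt (n : ℕ) : Type := Fin n → ℝ

/-- Partial derivative `∂_a f` of a scalar function. -/
def pd {n : ℕ} (f : Pt n → ℝ) (a : Fin n) (x : Pt n) : ℝ :=
  fderiv ℝ f x (Pi.single a 1)

/-- Pairing of a covector (components `ω`) with a vector (components `u`). -/
def ip {n : ℕ} (ω u : Fin n → ℝ) : ℝ := ∑ α, ω α * u α

/-- Scalar product of two vectors with respect to the metric `g`. -/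
def gdot {n : ℕ} (g : Pt n → Fin n → Fin n → ℝ) (x : Pt n) (u v : Fin n → ℝ) : ℝ :=
  ∑ a, ∑ b, g x a b * u a * v b

/-- Index lowering: the 1-form `ξ_♭` metrically dual to the vector field `ξ`. -/
def flat {n : ℕ} (g : Pt n → Fin n → Fin n → ℝ) (ξ : Pt n → Pt n) (x : Pt n) (b : Fin n) : ℝ :=
  ∑ c, g x b c * ξ x c

/-- Lie derivative `(ℒ_ξ g)_{ab}` of a symmetric 2-covariant tensor field `g`
along the vector field `ξ`. -/
def lieD {n : ℕ} (g : Pt n → Fin n → Fin n → ℝ) (ξ : Pt n → Pt n) (x : Pt n) (a b : Fin n) : ℝ :=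
  ∑ c, (ξ x c * pd (fun y => g y a b) c x
      + g x c b * pd (fun y => ξ y c) a x
      + g x a c * pd (fun y => ξ y c) b x)

/-- Lie bracket `[ξ, η]` of two vector fields. -/
def lieBr {n : ℕ} (ξ η : Pt n → Pt n) (x : Pt n) : Pt n :=
  fun a => ∑ b, (ξ x b * pd (fun y => η y a) b x - η x b * pd (fun y => ξ y a) b x)

/-- Christoffel symbols `Γ^a_{bc}` of the Levi-Civita connection of `g`
(`ginv` is the inverse metric). -/
def Chr {n : ℕ} (g ginv : Pt n → Fin n → Fin n → ℝ) (a b c : Fin n) (x : Pt n) : ℝ :=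
  (1/2) * ∑ d, ginv x a d *
    (pd (fun y => g y d b) c x + pd (fun y => g y d c) b x - pd (fun y => g y b c) d x)

/-- Covariant derivative `∇_a ω_b` of a 1-form `ω`. -/
def covD {n : ℕ} (g ginv : Pt n → Fin n → Fin n → ℝ) (ω : Pt n → Fin n → ℝ)
    (x : Pt n) (a b : Fin n) : ℝ :=
  pd (fun y => ω y b) a x - ∑ c, Chr g ginv c a b x * ω x c

/-- Covariant derivative `∇_m S_{abcd}` of a 4-covariant tensor field `S`. -/
def covD4 {n : ℕ} (g ginv : Pt n → Fin n → Fin n → ℝ)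
    (S : Pt n → Fin n → Fin n → Fin n → Fin n → ℝ) (x : Pt n) (m a b c d : Fin n) : ℝ :=
  pd (fun y => S y a b c d) m x
    - ∑ e, Chr g ginv e m a x * S x e b c d
    - ∑ e, Chr g ginv e m b x * S x a e c d
    - ∑ e, Chr g ginv e m c x * S x a b e d
    - ∑ e, Chr g ginv e m d x * S x a b c e

/-- Riemann tensor `R^a_{bcd}` of the Levi-Civita connection. -/
def Riem {n : ℕ} (g ginv : Pt n → Fin n → Fin n → ℝ) (a b c d : Fin n) (x : Pt n) : ℝ :=
  pd (fun y => Chr g ginv a d b y) c x - pd (fun y => Chr g ginv a c b y) d x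
    + ∑ e, (Chr g ginv a c e x * Chr g ginv e d b x - Chr g ginv a d e x * Chr g ginv e c b x)

/-- Ricci tensor `R_{bd} = R^a_{bad}`. -/
def RicciT {n : ℕ} (g ginv : Pt n → Fin n → Fin n → ℝ) (b d : Fin n) (x : Pt n) : ℝ :=
  ∑ a, Riem g ginv a b a d x

/-- Normalized antisymmetrization of a 3-index quantity. -/
def asym3 {ι : Type*} (T : ι → ι → ι → ℝ) (a b c : ι) : ℝ :=
  (1/6) * ∑ σ : Equiv.Perm (Fin 3),
    ((Equiv.Perm.sign σ : ℤ) : ℝ) * T (![a, b, c] (σ 0)) (![a, b, c] (σ 1)) (![a, b, c] (σ 2))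

/-- Normalized antisymmetrization of a 4-index quantity. -/
def asym4 {ι : Type*} (T : ι → ι → ι → ι → ℝ) (a b c d : ι) : ℝ :=
  (1/24) * ∑ σ : Equiv.Perm (Fin 4),
    ((Equiv.Perm.sign σ : ℤ) : ℝ) *
      T (![a, b, c, d] (σ 0)) (![a, b, c, d] (σ 1)) (![a, b, c, d] (σ 2)) (![a, b, c, d] (σ 3))

/-- Pullback `Φ* g` of a 2-covariant tensor field along a map `Φ`
(first fundamental form when `Φ` is an embedding and `g` the metric). -/
def pull2 {d m : ℕ} (Φ : Pt d → Pt m) (g : Pt m → Fin m → Fin m → ℝ)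
    (p : Pt d) (a b : Fin d) : ℝ :=
  ∑ α, ∑ β, g (Φ p) α β *
    fderiv ℝ Φ p (Pi.single a 1) α * fderiv ℝ Φ p (Pi.single b 1) β

/-- The tangent frame `e_a = dΦ(∂/∂λ^a)` along the hypersurface `Σ = Φ(σ)`. -/
def eF {d : ℕ} (Φ : Pt d → Pt (d+1)) (a : Fin d) (p : Pt d) : Pt (d+1) :=
  fderiv ℝ Φ p (Pi.single a 1)

/-- Exterior derivative `dω` of a 1-form evaluated on two vectors:
`dω(u,v) = u^α v^β (∂_α ω_β - ∂_β ω_α)`. -/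
def dext {n : ℕ} (ω : Pt n → Fin n → ℝ) (x : Pt n) (u v : Fin n → ℝ) : ℝ :=
  ∑ α, ∑ β, u α * v β * (pd (fun y => ω y β) α x - pd (fun y => ω y α) β x)

/-- Wedge product of two covectors evaluated on two vectors. -/
def wdg2 {n : ℕ} (ω τ : Fin n → ℝ) (u v : Fin n → ℝ) : ℝ :=
  ip ω u * ip τ v - ip ω v * ip τ u

/-- Wedge product of four covectors evaluated on four vectors (determinant convention). -/
def wdg4 {n : ℕ} (ω₁ ω₂ ω₃ ω₄ : Fin n → ℝ) (u : Fin 4 → Fin n → ℝ) : ℝ :=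
  ∑ σ : Equiv.Perm (Fin 4), ((Equiv.Perm.sign σ : ℤ) : ℝ) *
    (ip ω₁ (u (σ 0)) * ip ω₂ (u (σ 1)) * ip ω₃ (u (σ 2)) * ip ω₄ (u (σ 3)))

/-- The 4-form `A_♭ ∧ B_♭ ∧ d(B_♭)` built from two vector fields `A`, `B`
(indices lowered with `g`), evaluated on four vectors. -/
def form4 {n : ℕ} (g : Pt n → Fin n → Fin n → ℝ) (A B : Pt n → Pt n) (x : Pt n)
    (u : Fin 4 → Fin n → ℝ) : ℝ :=
  (1/2) * ∑ σ : Equiv.Perm (Fin 4), ((Equiv.Perm.sign σ : ℤ) : ℝ) *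
    (ip (flat g A x) (u (σ 0)) * ip (flat g B x) (u (σ 1)) *
      dext (flat g B) x (u (σ 2)) (u (σ 3)))

/-- Covariant derivative `∇_{e_a} ℓ` of a vector field `ℓ` defined along `Σ = Φ(σ)`. -/
def covVecS {d : ℕ} (g ginv : Pt (d+1) → Fin (d+1) → Fin (d+1) → ℝ) (Φ : Pt d → Pt (d+1))
    (ℓ : Pt d → Pt (d+1)) (a : Fin d) (p : Pt d) : Pt (d+1) :=
  fun μ => pd (fun q => ℓ q μ) a p + ∑ ν, ∑ ρ, Chr g ginv μ ν ρ (Φ p) * eF Φ a p ν * ℓ p ρ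

/-- The lowered components `ℓ_ν` along `Σ` of a vector field `ℓ` defined along `Σ`. -/
def flatS {d : ℕ} (g : Pt (d+1) → Fin (d+1) → Fin (d+1) → ℝ) (Φ : Pt d → Pt (d+1))
    (ℓ : Pt d → Pt (d+1)) (p : Pt d) (ν : Fin (d+1)) : ℝ :=
  ∑ ρ, g (Φ p) ν ρ * ℓ p ρ

/-- Generalized second fundamental form `H_{ab} = e_a^μ e_b^ν ∇_μ ℓ_ν`
with respect to the rigging `ℓ`. -/
def Hgen {d : ℕ} (g ginv : Pt (d+1) → Fin (d+1) → Fin (d+1) → ℝ) (Φ : Pt d → Pt (d+1))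
    (ℓ : Pt d → Pt (d+1)) (a b : Fin d) (p : Pt d) : ℝ :=
  ∑ ν, eF Φ b p ν * (pd (fun q => flatS g Φ ℓ q ν) a p
    - ∑ c, (∑ μ, eF Φ a p μ * Chr g ginv c μ ν (Φ p)) * flatS g Φ ℓ p c)

/-- Transversal component `B_a = 2 ℓ^α e_a^β ∇_{[α} ω_{β]}` of `dω` along `Σ`. -/
def Bcoef {d : ℕ} (g ginv : Pt (d+1) → Fin (d+1) → Fin (d+1) → ℝ) (Φ : Pt d → Pt (d+1))
    (ℓ : Pt d → Pt (d+1)) (ω : Pt (d+1) → Fin (d+1) → ℝ) (a : Fin d) (p : Pt d) : ℝ :=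
  ∑ α, ∑ β, ℓ p α * eF Φ a p β * (covD g ginv ω (Φ p) α β - covD g ginv ω (Φ p) β α)

/-- Tangential component `A_{ab} = e_{[a}(ω_{b]})` of `dω` along `Σ`. -/
def Acoef {d : ℕ} (Φ : Pt d → Pt (d+1)) (ω : Pt (d+1) → Fin (d+1) → ℝ)
    (a b : Fin d) (p : Pt d) : ℝ :=
  (1/2) * (pd (fun q => ip (ω (Φ q)) (eF Φ b q)) a p - pd (fun q => ip (ω (Φ q)) (eF Φ a q)) b p)

/-- The identified frame `{ℓ, e_a}` along `Σ`, indexed by `Option (Fin d)`. -/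
def frameV {d : ℕ} (Φ : Pt d → Pt (d+1)) (ℓ : Pt d → Pt (d+1)) (p : Pt d) :
    Option (Fin d) → Pt (d+1)
  | none => ℓ p
  | some a => eF Φ a p

section PartialDerivatives

lemma pd_mul {n : ℕ} {f h : Pt n → ℝ} (hf : Differentiable ℝ f) (hh : Differentiable ℝ h)
    (a : Fin n) (x : Pt n) :
    pd (fun y => f y * h y) a x = pd f a x * h x + f x * pd h a x := by
  unfold pd
  rw [fderiv_fun_mul (hf x) (hh x)]
  simp
  ring

lemma pd_sum {n : ℕ} {ι : Type*} (s : Finset ι) {f : ι → Pt n → ℝ}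
    (hf : ∀ i, Differentiable ℝ (f i)) (a : Fin n) (x : Pt n) :
    pd (fun y => ∑ i ∈ s, f i y) a x = ∑ i ∈ s, pd (f i) a x := by
  unfold pd
  rw [fderiv_fun_sum (fun i _ => hf i x)]
  simp

lemma pd_sum_mul {n : ℕ} {ι : Type*} [Fintype ι] {f h : ι → Pt n → ℝ}
    (hf : ∀ i, Differentiable ℝ (f i)) (hh : ∀ i, Differentiable ℝ (h i)) (a : Fin n) (x : Pt n) :
    pd (fun y => ∑ i, f i y * h i y) a x = ∑ i, (pd (f i) a x * h i x + f i x * pd (h i) a x) := by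
  rw [pd_sum _ fun i => (hf i).fun_mul (hh i)]
  exact Finset.sum_congr rfl fun i _ => pd_mul (hf i) (hh i) a x

lemma fderiv_apply_eq_sum_pd {n : ℕ} {f : Pt n → ℝ} (x v : Pt n) :
    fderiv ℝ f x v = ∑ μ, v μ * pd f μ x := by
  have hv : v = ∑ μ, v μ • (Pi.single μ (1 : ℝ) : Pt n) := by
    ext i
    simp [Finset.sum_apply, Pi.single_apply]
  conv_lhs => rw [hv]
  simp [map_sum, pd]

lemma pd_comp {n m : ℕ} {f : Pt m → ℝ} {Φ : Pt n → Pt m} (hf : Differentiable ℝ f)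
    (hΦ : Differentiable ℝ Φ) (a : Fin n) (p : Pt n) :
    pd (fun q => f (Φ q)) a p =
      ∑ μ, fderiv ℝ Φ p (Pi.single a 1) μ * pd f μ (Φ p) := by
  have h := fderiv_comp p (hf (Φ p)) (hΦ p)
  rw [← fderiv_apply_eq_sum_pd]
  have h2 : pd (fun q => f (Φ q)) a p = fderiv ℝ (f ∘ Φ) p (Pi.single a 1) := rfl
  rw [h2, h]
  rfl

lemma fderiv_eq_sum_eF {d : ℕ} (Φ : Pt d → Pt (d+1)) (p v : Pt d) (μ : Fin (d+1)) :
    fderiv ℝ Φ p v μ = ∑ b, v b * eF Φ b p μ := by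
  have hv : v = ∑ μ, v μ • (Pi.single μ (1 : ℝ) : Pt d) := by
    ext i
    simp [Finset.sum_apply, Pi.single_apply]
  conv_lhs => rw [hv]
  simp [map_sum, eF]

lemma contDiff_one_fderiv {n m : ℕ} {Φ : Pt n → Pt m} (hΦ : ContDiff ℝ (⊤ : ℕ∞) Φ) :
    ContDiff ℝ 1 (fderiv ℝ Φ) :=
  hΦ.fderiv_right (WithTop.coe_le_coe.2 (le_top : (2 : ℕ∞) ≤ ⊤))

lemma differentiable_eF {d : ℕ} {Φ : Pt d → Pt (d+1)} (hΦ : ContDiff ℝ (⊤ : ℕ∞) Φ)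
    (a : Fin d) (μ : Fin (d+1)) : Differentiable ℝ (fun q => eF Φ a q μ) := by
  have h1 : Differentiable ℝ (fderiv ℝ Φ) := (contDiff_one_fderiv hΦ).differentiable one_ne_zero
  unfold eF
  fun_prop

lemma pd_eF_symm {d : ℕ} {Φ : Pt d → Pt (d+1)} (hΦ : ContDiff ℝ (⊤ : ℕ∞) Φ)
    (a b : Fin d) (μ : Fin (d+1)) (p : Pt d) :
    pd (fun q => eF Φ b q μ) a p = pd (fun q => eF Φ a q μ) b p := by
  have h1 : Differentiable ℝ (fderiv ℝ Φ) := (contDiff_one_fderiv hΦ).differentiable one_ne_zero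
  have hs : IsSymmSndFDerivAt ℝ Φ p := by
    apply (hΦ.contDiffAt).isSymmSndFDerivAt
    simp only [minSmoothness_of_isRCLikeNormedField]
    exact WithTop.coe_le_coe.2 (le_top : (2 : ℕ∞) ≤ ⊤)
  have key : ∀ a b : Fin d, pd (fun q => eF Φ b q μ) a p =
      fderiv ℝ (fderiv ℝ Φ) p (Pi.single a 1) (Pi.single b 1) μ := by
    intro a b
    have h2 : HasFDerivAt (fun q => eF Φ b q μ)
        ((ContinuousLinearMap.proj (R := ℝ) (φ := fun _ : Fin (d+1) => ℝ) μ).comp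
          ((ContinuousLinearMap.apply ℝ (Pt (d+1)) (Pi.single b 1 : Pt d)).comp
            (fderiv ℝ (fderiv ℝ Φ) p))) p := by
      have h3 := (h1 p).hasFDerivAt
      exact ((ContinuousLinearMap.proj (R := ℝ) (φ := fun _ : Fin (d+1) => ℝ)
        μ).hasFDerivAt.comp p
          (((ContinuousLinearMap.apply ℝ (Pt (d+1)) (Pi.single b 1 : Pt d)).hasFDerivAt).comp
            p h3))
    unfold pd
    rw [h2.fderiv]
    rfl
  rw [key, key, hs.eq]

end PartialDerivatives

section Frames

/-- The coframe dual to `frameV`. -/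
def coframe {d : ℕ} (n : Pt d → Fin (d+1) → ℝ) (w : Fin d → Pt d → Fin (d+1) → ℝ)
    (p : Pt d) : Option (Fin d) → Fin (d+1) → ℝ
  | none => n p
  | some a => w a p

lemma eq_sum_coframe {d : ℕ} {Φ : Pt d → Pt (d+1)} {ℓ : Pt d → Pt (d+1)}
    {n : Pt d → Fin (d+1) → ℝ} {w : Fin d → Pt d → Fin (d+1) → ℝ}
    (hnℓ : ∀ p, ip (n p) (ℓ p) = 1) (hne : ∀ p a, ip (n p) (eF Φ a p) = 0)
    (hwℓ : ∀ p a, ip (w a p) (ℓ p) = 0)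
    (hwe : ∀ p a b, ip (w a p) (eF Φ b p) = if a = b then (1:ℝ) else 0)
    (p : Pt d) (u : Pt (d+1)) :
    u = fun μ => ∑ i, ip (coframe n w p i) u * frameV Φ ℓ p i μ := by
  have hAB : (Matrix.of (coframe n w p)) * (Matrix.of (frameV Φ ℓ p)).transpose = 1 := by
    ext i j
    rw [Matrix.mul_apply]
    change ip (coframe n w p i) (frameV Φ ℓ p j) = _
    rcases i with _ | a <;> rcases j with _ | b <;>
      simp [coframe, frameV, hnℓ, hne, hwℓ, hwe, Matrix.one_apply]
  rw [Matrix.mul_eq_one_comm_of_card_eq _ _ _ (by simp)] at hAB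
  ext μ
  have h : ((Matrix.of (frameV Φ ℓ p)).transpose *
      Matrix.of (coframe n w p)).mulVec u μ = u μ := by rw [hAB]; simp
  rw [← Matrix.mulVec_mulVec] at h
  rw [← h]
  simp only [Matrix.mulVec, dotProduct, Matrix.transpose_apply, Matrix.of_apply, ip]
  exact Finset.sum_congr rfl fun i _ => mul_comm _ _

lemma ip_sum_right {n : ℕ} {ι : Type*} [Fintype ι] (ω : Fin n → ℝ) (c : ι → ℝ)
    (F : ι → Fin n → ℝ) :
    ip ω (fun μ => ∑ i, c i * F i μ) = ∑ i, c i * ip ω (F i) := by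
  simp only [ip, Finset.mul_sum]
  rw [Finset.sum_comm]
  exact Finset.sum_congr rfl fun i _ => Finset.sum_congr rfl fun j _ => by ring

lemma dext_sum_left {n : ℕ} {ι : Type*} [Fintype ι] (ω : Pt n → Fin n → ℝ) (x : Pt n)
    (c : ι → ℝ) (F : ι → Fin n → ℝ) (v : Fin n → ℝ) :
    dext ω x (fun μ => ∑ i, c i * F i μ) v = ∑ i, c i * dext ω x (F i) v := by
  simp only [dext, Finset.mul_sum, Finset.sum_mul]
  rw [Finset.sum_congr rfl fun α _ => Finset.sum_comm, Finset.sum_comm]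
  exact Finset.sum_congr rfl fun i _ => Finset.sum_congr rfl fun j _ =>
    Finset.sum_congr rfl fun k _ => by ring

lemma dext_swap {n : ℕ} (ω : Pt n → Fin n → ℝ) (x : Pt n) (u v : Fin n → ℝ) :
    dext ω x u v = - dext ω x v u := by
  simp only [dext, ← Finset.sum_neg_distrib]
  rw [Finset.sum_comm]
  exact Finset.sum_congr rfl fun i _ => Finset.sum_congr rfl fun j _ => by ring

lemma dext_sum_right {n : ℕ} {ι : Type*} [Fintype ι] (ω : Pt n → Fin n → ℝ) (x : Pt n)
    (c : ι → ℝ) (F : ι → Fin n → ℝ) (u : Fin n → ℝ) :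
    dext ω x u (fun μ => ∑ i, c i * F i μ) = ∑ i, c i * dext ω x u (F i) := by
  rw [dext_swap, dext_sum_left, ← Finset.sum_neg_distrib]
  refine Finset.sum_congr rfl fun i _ => ?_
  rw [dext_swap ω x u]
  ring

end Frames

section TangentFields

variable {d : ℕ} {g ginv : Pt (d+1) → Fin (d+1) → Fin (d+1) → ℝ} {Φ ℓ : Pt d → Pt (d+1)}
  {η : Pt (d+1) → Pt (d+1)} {γ : Pt d → Pt d}

lemma apply_eq_sum_eF (hrel : ∀ p, fderiv ℝ Φ p (γ p) = η (Φ p)) (p : Pt d) (μ : Fin (d+1)) :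
    η (Φ p) μ = ∑ b, γ p b * eF Φ b p μ := by
  rw [← hrel, fderiv_eq_sum_eF]

lemma ip_flat (x : Pt (d+1)) (v : Fin (d+1) → ℝ) :
    ip (flat g η x) v = gdot g x v (η x) := by
  simp only [ip, flat, gdot, Finset.sum_mul]
  exact Finset.sum_congr rfl fun i _ => Finset.sum_congr rfl fun j _ => by ring

lemma gdot_sum_right {ι : Type*} [Fintype ι] (x : Pt (d+1)) (u : Fin (d+1) → ℝ) (c : ι → ℝ)
    (F : ι → Fin (d+1) → ℝ) :
    gdot g x u (fun μ => ∑ i, c i * F i μ) = ∑ i, c i * gdot g x u (F i) := by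
  simp only [gdot, Finset.mul_sum]
  rw [Finset.sum_congr rfl fun α _ => Finset.sum_comm, Finset.sum_comm]
  exact Finset.sum_congr rfl fun i _ => Finset.sum_congr rfl fun j _ =>
    Finset.sum_congr rfl fun k _ => by ring

lemma ip_flat_eq_sum (hrel : ∀ p, fderiv ℝ Φ p (γ p) = η (Φ p)) (p : Pt d)
    (v : Fin (d+1) → ℝ) :
    ip (flat g η (Φ p)) v = ∑ b, γ p b * gdot g (Φ p) v (eF Φ b p) := by
  rw [ip_flat, ← gdot_sum_right]
  congr 1
  ext μ
  exact apply_eq_sum_eF hrel p μ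

lemma gdot_eF (p : Pt d) (a b : Fin d) :
    gdot g (Φ p) (eF Φ a p) (eF Φ b p) = pull2 Φ g p a b := rfl

/-- Cartan's formula for the coordinate fields of the hypersurface. -/
lemma dext_eF_eF {ω : Pt (d+1) → Fin (d+1) → ℝ} (hω : ∀ β, Differentiable ℝ fun y => ω y β)
    (hΦ : ContDiff ℝ (⊤ : ℕ∞) Φ) (p : Pt d) (a b : Fin d) :
    dext ω (Φ p) (eF Φ a p) (eF Φ b p) =
      pd (fun q => ip (ω (Φ q)) (eF Φ b q)) a p - pd (fun q => ip (ω (Φ q)) (eF Φ a q)) b p := by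
  have hΦd : Differentiable ℝ Φ := hΦ.differentiable (by simp)
  have key : ∀ a b : Fin d, pd (fun q => ip (ω (Φ q)) (eF Φ b q)) a p =
      (∑ β, ∑ α, eF Φ a p α * pd (fun y => ω y β) α (Φ p) * eF Φ b p β)
        + ∑ β, ω (Φ p) β * pd (fun q => eF Φ b q β) a p := by
    intro a b
    unfold ip
    have hωΦ : ∀ β, Differentiable ℝ fun q => ω (Φ q) β := fun β => (hω β).comp hΦd
    rw [pd_sum_mul hωΦ (differentiable_eF hΦ b), ← Finset.sum_add_distrib]
    refine Finset.sum_congr rfl fun β _ => ?_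
    congr 1
    rw [← Finset.sum_mul]
    exact congrArg (· * eF Φ b p β) (pd_comp (hω β) hΦd a p)
  rw [key, key]
  simp only [pd_eF_symm hΦ a b]
  simp only [dext, mul_sub, Finset.sum_sub_distrib]
  rw [add_sub_add_right_eq_sub]
  congr 1
  · rw [Finset.sum_comm]
    exact Finset.sum_congr rfl fun i _ => Finset.sum_congr rfl fun j _ => by ring
  · exact Finset.sum_congr rfl fun i _ => Finset.sum_congr rfl fun j _ => by ring

/-- Christoffel symbols of the first kind. -/
def chrLow {n : ℕ} (g : Pt n → Fin n → Fin n → ℝ) (ρ μ ν : Fin n) (x : Pt n) : ℝ :=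
  (1/2) * (pd (fun y => g y ρ μ) ν x + pd (fun y => g y ρ ν) μ x - pd (fun y => g y μ ν) ρ x)

lemma sum_Chr_mul_lower (hgsymm : ∀ x a b, g x a b = g x b a)
    (hinv : ∀ x a b, (∑ c, ginv x a c * g x c b) = if a = b then (1:ℝ) else 0)
    (x v : Pt (d+1)) (μ ν : Fin (d+1)) :
    ∑ c, Chr g ginv c μ ν x * (∑ ρ, g x c ρ * v ρ) = ∑ ρ, chrLow g ρ μ ν x * v ρ := by
  have hA : (Matrix.of (ginv x)) * (Matrix.of (g x)) = 1 := by
    ext i j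
    rw [Matrix.mul_apply, Matrix.one_apply]
    exact hinv x i j
  have hB := mul_eq_one_comm.mp hA
  have hB' : ∀ ρ e, ∑ c, g x c ρ * ginv x c e = if e = ρ then (1:ℝ) else 0 := by
    intro ρ e
    have h := congrFun (congrFun hB ρ) e
    rw [Matrix.mul_apply, Matrix.one_apply] at h
    simp only [Matrix.of_apply] at h
    rw [Finset.sum_congr rfl fun c _ => by rw [hgsymm x c ρ], h]
    simp [eq_comm]
  have h1 : ∀ c, Chr g ginv c μ ν x = ∑ e, ginv x c e * chrLow g e μ ν x := by
    intro c
    simp only [Chr, chrLow, Finset.mul_sum]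
    exact Finset.sum_congr rfl fun i _ => by ring
  calc ∑ c, Chr g ginv c μ ν x * (∑ ρ, g x c ρ * v ρ)
      = ∑ ρ, ∑ e, (∑ c, g x c ρ * ginv x c e) * (chrLow g e μ ν x * v ρ) := by
        simp only [h1, Finset.mul_sum, Finset.sum_mul]
        rw [Finset.sum_comm]
        refine Finset.sum_congr rfl fun ρ _ => ?_
        rw [Finset.sum_comm]
        exact Finset.sum_congr rfl fun i _ => Finset.sum_congr rfl fun j _ => by ring
    _ = _ := by simp [hB']

lemma pd_flat (hg : ∀ a b, Differentiable ℝ fun x => g x a b)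
    (hη : ∀ a, Differentiable ℝ fun x => η x a) (α β : Fin (d+1)) (x : Pt (d+1)) :
    pd (fun y => flat g η y α) β x =
      ∑ c, (pd (fun y => g y α c) β x * η x c + g x α c * pd (fun y => η y c) β x) := by
  unfold flat
  exact pd_sum_mul (hg α) hη β x

/-- The exterior derivative of a metric-dual 1-form, in terms of the Lie derivative of `g`. -/
lemma pd_flat_sub_pd_flat (hg : ∀ a b, Differentiable ℝ fun x => g x a b)
    (hgsymm : ∀ x a b, g x a b = g x b a)
    (hη : ∀ a, Differentiable ℝ fun x => η x a) (α β : Fin (d+1)) (x : Pt (d+1)) :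
    pd (fun y => flat g η y β) α x - pd (fun y => flat g η y α) β x =
      lieD g η x α β - 2 * ∑ c, (chrLow g α β c x * η x c + g x α c * pd (fun y => η y c) β x) := by
  rw [pd_flat hg hη, pd_flat hg hη, lieD, Finset.mul_sum, ← Finset.sum_sub_distrib,
    ← Finset.sum_sub_distrib]
  refine Finset.sum_congr rfl fun c _ => ?_
  have e1 : (fun y => g y β c) = fun y => g y c β := funext fun y => hgsymm y β c
  have e2 : (fun y => g y α c) = fun y => g y c α := funext fun y => hgsymm y α c
  have e3 : (fun y => g y α β) = fun y => g y β α := funext fun y => hgsymm y α β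
  simp only [chrLow, e1, e2, e3, hgsymm x β c]
  ring

lemma sum_mul_Hgen (hgsymm : ∀ x a b, g x a b = g x b a)
    (hinv : ∀ x a b, (∑ c, ginv x a c * g x c b) = if a = b then (1:ℝ) else 0)
    (hrel : ∀ p, fderiv ℝ Φ p (γ p) = η (Φ p)) (p : Pt d) (a : Fin d) :
    ∑ b, γ p b * Hgen g ginv Φ ℓ a b p =
      ∑ ν, η (Φ p) ν * pd (fun q => flatS g Φ ℓ q ν) a p
        - ∑ α, ∑ β, ℓ p α * eF Φ a p β * ∑ c, chrLow g α β c (Φ p) * η (Φ p) c := by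
  have h1 : ∀ ν, ∑ c, (∑ μ, eF Φ a p μ * Chr g ginv c μ ν (Φ p)) * flatS g Φ ℓ p c =
      ∑ α, ∑ β, ℓ p α * eF Φ a p β * chrLow g α β ν (Φ p) := by
    intro ν
    have h2 : ∑ c, (∑ μ, eF Φ a p μ * Chr g ginv c μ ν (Φ p)) * flatS g Φ ℓ p c =
        ∑ μ, eF Φ a p μ * ∑ c, Chr g ginv c μ ν (Φ p) * (∑ ρ, g (Φ p) c ρ * ℓ p ρ) := by
      simp only [Finset.sum_mul (s := Finset.univ), Finset.mul_sum (s := Finset.univ), flatS]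
      rw [Finset.sum_comm]
      exact Finset.sum_congr rfl fun i _ => Finset.sum_congr rfl fun j _ =>
        Finset.sum_congr rfl fun k _ => by ring
    rw [h2, Finset.sum_congr rfl fun μ _ => by
      rw [sum_Chr_mul_lower hgsymm hinv (Φ p) (ℓ p) μ ν]]
    simp only [Finset.mul_sum]
    rw [Finset.sum_comm]
    refine Finset.sum_congr rfl fun i _ => Finset.sum_congr rfl fun j _ => ?_
    simp only [chrLow]
    ring
  simp only [Hgen, h1]
  have h3 : ∀ X : Fin (d+1) → ℝ, ∑ b, γ p b * ∑ ν, eF Φ b p ν * X ν = ∑ ν, η (Φ p) ν * X ν := by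
    intro X
    simp only [apply_eq_sum_eF hrel, Finset.mul_sum, Finset.sum_mul]
    rw [Finset.sum_comm]
    exact Finset.sum_congr rfl fun i _ => Finset.sum_congr rfl fun j _ => by ring
  rw [h3]
  simp only [mul_sub, Finset.sum_sub_distrib, Finset.mul_sum]
  congr 1
  rw [Finset.sum_comm]
  refine Finset.sum_congr rfl fun i _ => ?_
  rw [Finset.sum_comm]
  exact Finset.sum_congr rfl fun j _ => Finset.sum_congr rfl fun k _ => by ring

lemma dext_flat_rigging_eF (hg : ∀ a b, Differentiable ℝ fun x => g x a b)
    (hgsymm : ∀ x a b, g x a b = g x b a)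
    (hinv : ∀ x a b, (∑ c, ginv x a c * g x c b) = if a = b then (1:ℝ) else 0)
    (hη : ∀ a, Differentiable ℝ fun x => η x a) (hΦ : Differentiable ℝ Φ)
    (hℓ : ∀ a, Differentiable ℝ fun x => ℓ x a)
    (hrel : ∀ p, fderiv ℝ Φ p (γ p) = η (Φ p)) {κ : Pt (d+1) → ℝ}
    (hconf : ∀ x a b, lieD g η x a b = κ x * g x a b) (p : Pt d) (a : Fin d) :
    dext (flat g η) (Φ p) (ℓ p) (eF Φ a p) =
      κ (Φ p) * gdot g (Φ p) (ℓ p) (eF Φ a p)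
        - 2 * (pd (fun q => ip (flat g η (Φ q)) (ℓ q)) a p
          - ∑ b, γ p b * Hgen g ginv Φ ℓ a b p) := by
  have hfl : ∀ ν, Differentiable ℝ (fun q => flatS g Φ ℓ q ν) := by
    intro ν
    unfold flatS
    have : ∀ ρ, Differentiable ℝ (fun q => g (Φ q) ν ρ) := fun ρ => (hg ν ρ).comp hΦ
    fun_prop
  have hip : (fun q => ip (flat g η (Φ q)) (ℓ q)) =
      fun q => ∑ ν, η (Φ q) ν * flatS g Φ ℓ q ν := by
    ext q
    simp only [ip, flat, flatS, Finset.sum_mul, Finset.mul_sum]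
    rw [Finset.sum_comm]
    refine Finset.sum_congr rfl fun i _ => Finset.sum_congr rfl fun j _ => ?_
    rw [hgsymm (Φ q) j i]
    ring
  have hpd : pd (fun q => ip (flat g η (Φ q)) (ℓ q)) a p =
      ∑ ν, η (Φ p) ν * pd (fun q => flatS g Φ ℓ q ν) a p +
      ∑ α, ∑ β, ℓ p α * eF Φ a p β * ∑ c, g (Φ p) α c * pd (fun y => η y c) β (Φ p) := by
    have h1 : ∀ ν, pd (fun q => η (Φ q) ν) a p =
        ∑ β, eF Φ a p β * pd (fun y => η y ν) β (Φ p) := fun ν => pd_comp (hη ν) hΦ a p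
    have hηΦ : ∀ ν, Differentiable ℝ fun q => η (Φ q) ν := fun ν => (hη ν).comp hΦ
    rw [hip, pd_sum_mul hηΦ hfl, Finset.sum_add_distrib, add_comm]
    congr 1
    simp only [h1]
    simp only [flatS, Finset.sum_mul, Finset.mul_sum]
    rw [Finset.sum_congr rfl fun α _ => Finset.sum_comm, Finset.sum_comm,
      Finset.sum_congr rfl fun α _ => Finset.sum_comm, Finset.sum_comm]
    refine Finset.sum_congr rfl fun i _ => Finset.sum_congr rfl fun j _ =>
      Finset.sum_congr rfl fun k _ => ?_
    rw [hgsymm (Φ p) i k]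
    ring
  rw [hpd, sum_mul_Hgen hgsymm hinv hrel]
  simp only [dext, pd_flat_sub_pd_flat hg hgsymm hη, hconf, gdot, Finset.sum_add_distrib,
    mul_sub, mul_add, Finset.sum_sub_distrib]
  have : ∀ X Y : Fin (d+1) → Fin (d+1) → ℝ,
      ∑ α, ∑ β, X α β * (2 * Y α β) = 2 * ∑ α, ∑ β, X α β * Y α β := by
    intro X Y
    simp only [Finset.mul_sum]
    exact Finset.sum_congr rfl fun i _ => Finset.sum_congr rfl fun j _ => by ring
  have h2 : ∑ α, ∑ β, ℓ p α * eF Φ a p β * (κ (Φ p) * g (Φ p) α β) =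
      κ (Φ p) * ∑ α, ∑ β, g (Φ p) α β * ℓ p α * eF Φ a p β := by
    simp only [Finset.mul_sum]
    exact Finset.sum_congr rfl fun i _ => Finset.sum_congr rfl fun j _ => by ring
  rw [h2, this fun α β => ℓ p α * eF Φ a p β, this fun α β => ℓ p α * eF Φ a p β]
  ring

/-- Naturality of the Lie derivative under pullback. -/
lemma pull2_lieD (hg : ∀ a b, Differentiable ℝ fun x => g x a b)
    (hη : ∀ a, Differentiable ℝ fun x => η x a) (hΦ : ContDiff ℝ (⊤ : ℕ∞) Φ)
    (hγ : ∀ a, Differentiable ℝ fun x => γ x a)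
    (hrel : ∀ p, fderiv ℝ Φ p (γ p) = η (Φ p)) (p : Pt d) (a b : Fin d) :
    pull2 Φ (lieD g η) p a b = lieD (pull2 Φ g) γ p a b := by
  have hΦd : Differentiable ℝ Φ := hΦ.differentiable (by simp)
  have hDη : ∀ (a : Fin d) (ν : Fin (d+1)),
      ∑ α, eF Φ a p α * pd (fun y => η y ν) α (Φ p) =
        ∑ c, (pd (fun y => γ y c) a p * eF Φ c p ν
          + γ p c * pd (fun q => eF Φ a q ν) c p) := by
    intro a ν
    refine (pd_comp (hη ν) hΦd a p).symm.trans ?_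
    rw [show (fun q => η (Φ q) ν) = fun q => ∑ c, γ q c * eF Φ c q ν from
      funext fun q => apply_eq_sum_eF hrel q ν, pd_sum_mul hγ (differentiable_eF hΦ · ν)]
    simp only [pd_eF_symm hΦ a]
  have hpd : ∀ c, pd (fun q => pull2 Φ g q a b) c p =
      ∑ α, ∑ β, ((∑ μ, eF Φ c p μ * pd (fun y => g y α β) μ (Φ p)) * eF Φ a p α * eF Φ b p β
        + g (Φ p) α β * pd (fun q => eF Φ a q α) c p * eF Φ b p β
        + g (Φ p) α β * eF Φ a p α * pd (fun q => eF Φ b q β) c p) := by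
    intro c
    have hgΦ : ∀ α β, Differentiable ℝ fun q => g (Φ q) α β := fun α β => (hg α β).comp hΦd
    have hgc : ∀ α β, pd (fun q => g (Φ q) α β) c p =
      ∑ μ, eF Φ c p μ * pd (fun y => g y α β) μ (Φ p) := fun α β => pd_comp (hg α β) hΦd c p
    have hge : ∀ α β, Differentiable ℝ fun q => g (Φ q) α β * eF Φ a q α := fun α β =>
      (hgΦ α β).fun_mul (differentiable_eF hΦ a α)
    change pd (fun q => ∑ α, ∑ β, g (Φ q) α β * eF Φ a q α * eF Φ b q β) c p = _
    rw [pd_sum _ fun α => Differentiable.fun_sum fun β _ =>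
      (hge α β).fun_mul (differentiable_eF hΦ b β)]
    refine Finset.sum_congr rfl fun α _ => ?_
    rw [pd_sum_mul (hge α) (differentiable_eF hΦ b)]
    refine Finset.sum_congr rfl fun β _ => ?_
    rw [pd_mul (hgΦ α β) (differentiable_eF hΦ a α), hgc]
    ring
  trans ∑ α, ∑ β, ((∑ μ, η (Φ p) μ * pd (fun y => g y α β) μ (Φ p)) * eF Φ a p α * eF Φ b p β
      + g (Φ p) α β * (∑ μ, eF Φ a p μ * pd (fun y => η y α) μ (Φ p)) * eF Φ b p β
      + g (Φ p) α β * eF Φ a p α * ∑ μ, eF Φ b p μ * pd (fun y => η y β) μ (Φ p))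
  · change ∑ α, ∑ β, lieD g η (Φ p) α β * eF Φ a p α * eF Φ b p β = _
    simp only [lieD, Finset.sum_add_distrib, add_mul]
    congr 1
    · congr 1
      simp only [Finset.mul_sum, Finset.sum_mul]
      rw [Finset.sum_comm]
      conv_rhs => rw [Finset.sum_comm]
      refine Finset.sum_congr rfl fun i _ => ?_
      rw [Finset.sum_comm]
      exact Finset.sum_congr rfl fun j _ => Finset.sum_congr rfl fun k _ => by ring
    · simp only [Finset.mul_sum, Finset.sum_mul]
      refine Finset.sum_congr rfl fun i _ => ?_
      rw [Finset.sum_comm]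
      exact Finset.sum_congr rfl fun j _ => Finset.sum_congr rfl fun k _ => by ring
  · have hpull : ∀ a b, pull2 Φ g p a b = ∑ α, ∑ β, g (Φ p) α β * eF Φ a p α * eF Φ b p β :=
      fun _ _ => rfl
    simp only [lieD, hpd, hDη, apply_eq_sum_eF hrel, hpull]
    simp only [Finset.mul_sum (s := (Finset.univ : Finset (Fin (d+1)))),
      Finset.sum_mul (s := (Finset.univ : Finset (Fin (d+1)))), ← Finset.sum_add_distrib]
    rw [Finset.sum_comm (s := (Finset.univ : Finset (Fin d)))]
    refine Finset.sum_congr rfl fun α _ => ?_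
    rw [Finset.sum_comm (s := (Finset.univ : Finset (Fin d)))]
    refine Finset.sum_congr rfl fun β _ => ?_
    simp only [Finset.mul_sum, Finset.sum_mul, mul_add, add_mul, Finset.sum_add_distrib]
    rw [Finset.sum_comm]
    simp only [mul_assoc, mul_comm, mul_left_comm]
    ring

end TangentFields

section Forms

lemma form4_eq_of_map {n : ℕ} {g g' : Pt n → Fin n → Fin n → ℝ} {A B A' B' : Pt n → Pt n}
    {x x' : Pt n} (T : Pt n → Pt n)
    (hA : ∀ u, ip (flat g A x) u = ip (flat g' A' x') (T u))
    (hB : ∀ u, ip (flat g B x) u = ip (flat g' B' x') (T u))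
    (hdB : ∀ u v, dext (flat g B) x u v = dext (flat g' B') x' (T u) (T v))
    (u : Fin 4 → Pt n) :
    form4 g A B x u = form4 g' A' B' x' fun k => T (u k) := by
  simp only [form4, hA, hB, hdB]

lemma form4_eq_zero_of_proportional {n : ℕ} {g : Pt n → Fin n → Fin n → ℝ} {A B : Pt n → Pt n}
    {x : Pt n} (ν : Fin n → ℝ) (a b : ℝ) (hA : ∀ u, ip (flat g A x) u = a * ip ν u)
    (hB : ∀ u, ip (flat g B x) u = b * ip ν u) (u : Fin 4 → Pt n) :
    form4 g A B x u = 0 := by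
  unfold form4
  set f : Equiv.Perm (Fin 4) → ℝ := fun σ => ((Equiv.Perm.sign σ : ℤ) : ℝ) *
    (ip (flat g A x) (u (σ 0)) * ip (flat g B x) (u (σ 1)) *
      dext (flat g B) x (u (σ 2)) (u (σ 3))) with hf
  have h : ∑ σ, f σ = ∑ σ, - f σ := by
    rw [← Equiv.sum_comp (Equiv.mulRight (Equiv.swap (0 : Fin 4) 1)) f]
    refine Finset.sum_congr rfl fun σ _ => ?_
    have h2 : Equiv.swap (0 : Fin 4) 1 2 = 2 := by decide
    have h3 : Equiv.swap (0 : Fin 4) 1 3 = 3 := by decide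
    have hs : Equiv.Perm.sign (σ * Equiv.swap 0 1) = -Equiv.Perm.sign σ := by
      simp [Equiv.Perm.sign_mul]
    simp only [hf, hA, hB, Equiv.coe_mulRight, hs, Equiv.Perm.mul_apply, Equiv.swap_apply_left,
      Equiv.swap_apply_right, h2, h3, Units.val_neg, Int.cast_neg]
    ring
  rw [Finset.sum_neg_distrib] at h
  linarith

end Forms

section Matching

variable {d : ℕ} {gp ginvp gm ginvm : Pt (d+1) → Fin (d+1) → Fin (d+1) → ℝ}
  {Φp Φm ℓp ℓm : Pt d → Pt (d+1)} {ηp ηm : Pt (d+1) → Pt (d+1)} {γ : Pt d → Pt d}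
  {κp κm : Pt (d+1) → ℝ}

lemma ip_flat_frameV_eq (hmatch : ∀ p a b, pull2 Φp gp p a b = pull2 Φm gm p a b)
    (hℓe : ∀ p a, gdot gp (Φp p) (ℓp p) (eF Φp a p) = gdot gm (Φm p) (ℓm p) (eF Φm a p))
    (hrelp : ∀ p, fderiv ℝ Φp p (γ p) = ηp (Φp p))
    (hrelm : ∀ p, fderiv ℝ Φm p (γ p) = ηm (Φm p)) (p : Pt d) (i : Option (Fin d)) :
    ip (flat gm ηm (Φm p)) (frameV Φm ℓm p i) = ip (flat gp ηp (Φp p)) (frameV Φp ℓp p i) := by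
  rw [ip_flat_eq_sum hrelp, ip_flat_eq_sum hrelm]
  rcases i with _ | a
  · simp only [frameV, hℓe]
  · simp only [frameV, gdot_eF, hmatch]

/-- Where the first fundamental form does not vanish, the exterior derivatives of the 1-forms
metrically dual to matched conformal Killing fields have the same components in the matched
frames. -/
lemma dext_flat_frameV_eq
    (hgp : ∀ a b, Differentiable ℝ fun x => gp x a b)
    (hgm : ∀ a b, Differentiable ℝ fun x => gm x a b)
    (hgpsymm : ∀ x a b, gp x a b = gp x b a) (hgmsymm : ∀ x a b, gm x a b = gm x b a)
    (hinvp : ∀ x a b, (∑ c, ginvp x a c * gp x c b) = if a = b then (1:ℝ) else 0)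
    (hinvm : ∀ x a b, (∑ c, ginvm x a c * gm x c b) = if a = b then (1:ℝ) else 0)
    (hΦp : ContDiff ℝ (⊤ : ℕ∞) Φp) (hΦm : ContDiff ℝ (⊤ : ℕ∞) Φm)
    (hℓp : ∀ a, Differentiable ℝ fun x => ℓp x a) (hℓm : ∀ a, Differentiable ℝ fun x => ℓm x a)
    (hηp : ∀ a, Differentiable ℝ fun x => ηp x a) (hηm : ∀ a, Differentiable ℝ fun x => ηm x a)
    (hγ : ∀ a, Differentiable ℝ fun x => γ x a)
    (hmatch : ∀ p a b, pull2 Φp gp p a b = pull2 Φm gm p a b)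
    (hℓe : ∀ p a, gdot gp (Φp p) (ℓp p) (eF Φp a p) = gdot gm (Φm p) (ℓm p) (eF Φm a p))
    (hH : ∀ p a b, Hgen gp ginvp Φp ℓp a b p = Hgen gm ginvm Φm ℓm a b p)
    (hrelp : ∀ p, fderiv ℝ Φp p (γ p) = ηp (Φp p))
    (hrelm : ∀ p, fderiv ℝ Φm p (γ p) = ηm (Φm p))
    (hconfp : ∀ x a b, lieD gp ηp x a b = κp x * gp x a b)
    (hconfm : ∀ x a b, lieD gm ηm x a b = κm x * gm x a b)
    {p : Pt d} (hne : ∃ a b, pull2 Φm gm p a b ≠ 0) (i j : Option (Fin d)) :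
    dext (flat gm ηm) (Φm p) (frameV Φm ℓm p i) (frameV Φm ℓm p j) =
      dext (flat gp ηp) (Φp p) (frameV Φp ℓp p i) (frameV Φp ℓp p j) := by
  have hip := ip_flat_frameV_eq hmatch hℓe hrelp hrelm
  have hiℓ : ∀ q, ip (flat gm ηm (Φm q)) (ℓm q) = ip (flat gp ηp (Φp q)) (ℓp q) :=
    fun q => hip q none
  have hie : ∀ q a, ip (flat gm ηm (Φm q)) (eF Φm a q) = ip (flat gp ηp (Φp q)) (eF Φp a q) :=
    fun q a => hip q (some a)
  have hκ : κm (Φm p) = κp (Φp p) := by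
    obtain ⟨a, b, hab⟩ := hne
    have hpull : ∀ {g : Pt (d+1) → Fin (d+1) → Fin (d+1) → ℝ} {Φ : Pt d → Pt (d+1)}
        {η : Pt (d+1) → Pt (d+1)} {κ : Pt (d+1) → ℝ},
        (∀ x a b, lieD g η x a b = κ x * g x a b) →
        pull2 Φ (lieD g η) p a b = κ (Φ p) * pull2 Φ g p a b := by
      intro g Φ η κ h
      simp only [pull2, h, Finset.mul_sum, mul_assoc]
    have hp := pull2_lieD hgp hηp hΦp hγ hrelp p a b
    have hm := pull2_lieD hgm hηm hΦm hγ hrelm p a b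
    have hpm : pull2 Φp gp = pull2 Φm gm := by
      ext q c e
      exact hmatch q c e
    rw [hpull hconfp, hpm] at hp
    rw [hpull hconfm, ← hp] at hm
    exact mul_right_cancel₀ hab hm
  have hflat : ∀ {g : Pt (d+1) → Fin (d+1) → Fin (d+1) → ℝ} {η : Pt (d+1) → Pt (d+1)},
      (∀ a b, Differentiable ℝ fun x => g x a b) → (∀ a, Differentiable ℝ fun x => η x a) →
      ∀ β, Differentiable ℝ fun y => flat g η y β := by
    intro g η hg hη β
    unfold flat
    fun_prop
  have hle : ∀ a, dext (flat gm ηm) (Φm p) (ℓm p) (eF Φm a p) =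
      dext (flat gp ηp) (Φp p) (ℓp p) (eF Φp a p) := by
    intro a
    rw [dext_flat_rigging_eF hgm hgmsymm hinvm hηm (hΦm.differentiable (by simp)) hℓm hrelm hconfm,
      dext_flat_rigging_eF hgp hgpsymm hinvp hηp (hΦp.differentiable (by simp)) hℓp hrelp hconfp]
    simp only [hκ, hℓe, hH, hiℓ]
  have hself : ∀ (ω : Pt (d+1) → Fin (d+1) → ℝ) x u, dext ω x u u = 0 := fun ω x u => by
    linarith [dext_swap ω x u u]
  rcases i with _ | a <;> rcases j with _ | b
  · simp only [hself]
  · exact hle b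
  · simp only [frameV]
    rw [dext_swap, hle, ← dext_swap]
  · simp only [frameV]
    rw [dext_eF_eF (hflat hgm hηm) hΦm, dext_eF_eF (hflat hgp hηp) hΦp]
    simp only [hie]

end Matching

/-- Corollary 1 of the paper: under a matching preserving a
two-dimensional conformal group as in Theorem 1, if the `G₂` acts orthogonally
transitively on the `(+)` side (the 4-forms `ξ⁺∧η⁺∧dη⁺` and `ξ⁺∧η⁺∧dξ⁺` vanish on
`W⁺ ⊇ Σ⁺`), then the corresponding forms of the `(−)` generators vanish on the
matching hypersurface. -/
theorem orthogonal_transitivity_preserved {d : ℕ}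
    (gp ginvp gm ginvm : Pt (d+1) → Fin (d+1) → Fin (d+1) → ℝ)
    (Φp Φm : Pt d → Pt (d+1)) (ℓp ℓm : Pt d → Pt (d+1))
    (np nm : Pt d → Fin (d+1) → ℝ) (wp wm : Fin d → Pt d → Fin (d+1) → ℝ)
    (ξp ηp ξm ηm : Pt (d+1) → Pt (d+1)) (γ₁ γ₂ : Pt d → Pt d)
    (αξp αξm αηp αηm : Pt (d+1) → ℝ)
    (hgp : ∀ a b, ContDiff ℝ (⊤ : ℕ∞) fun x => gp x a b)
    (hgm : ∀ a b, ContDiff ℝ (⊤ : ℕ∞) fun x => gm x a b)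
    (hginvp : ∀ a b, ContDiff ℝ (⊤ : ℕ∞) fun x => ginvp x a b)
    (hginvm : ∀ a b, ContDiff ℝ (⊤ : ℕ∞) fun x => ginvm x a b)
    (hgpsymm : ∀ x a b, gp x a b = gp x b a)
    (hgmsymm : ∀ x a b, gm x a b = gm x b a)
    (hinvp : ∀ x a b, (∑ c, ginvp x a c * gp x c b) = if a = b then (1:ℝ) else 0)
    (hinvm : ∀ x a b, (∑ c, ginvm x a c * gm x c b) = if a = b then (1:ℝ) else 0)
    (hΦp : ContDiff ℝ (⊤ : ℕ∞) Φp) (hΦpinj : Function.Injective Φp)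
    (hΦpimm : ∀ p, Function.Injective (fderiv ℝ Φp p))
    (hΦm : ContDiff ℝ (⊤ : ℕ∞) Φm) (hΦminj : Function.Injective Φm)
    (hΦmimm : ∀ p, Function.Injective (fderiv ℝ Φm p))
    (hℓp : ContDiff ℝ (⊤ : ℕ∞) ℓp) (hℓm : ContDiff ℝ (⊤ : ℕ∞) ℓm)
    (hξp : ContDiff ℝ (⊤ : ℕ∞) ξp) (hξm : ContDiff ℝ (⊤ : ℕ∞) ξm)
    (hηp : ContDiff ℝ (⊤ : ℕ∞) ηp) (hηm : ContDiff ℝ (⊤ : ℕ∞) ηm)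
    (hγ₁ : ContDiff ℝ (⊤ : ℕ∞) γ₁) (hγ₂ : ContDiff ℝ (⊤ : ℕ∞) γ₂)
    -- preliminary junction conditions
    (hmatch : ∀ p a b, pull2 Φp gp p a b = pull2 Φm gm p a b)
    -- duality of the coframes with the rigged frames on both sides
    (hnℓp : ∀ p, ip (np p) (ℓp p) = 1) (hnep : ∀ p a, ip (np p) (eF Φp a p) = 0)
    (hwℓp : ∀ p a, ip (wp a p) (ℓp p) = 0)
    (hwep : ∀ p a b, ip (wp a p) (eF Φp b p) = if a = b then (1:ℝ) else 0)
    (hnℓm : ∀ p, ip (nm p) (ℓm p) = 1) (hnem : ∀ p a, ip (nm p) (eF Φm a p) = 0)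
    (hwℓm : ∀ p a, ip (wm a p) (ℓm p) = 0)
    (hwem : ∀ p a b, ip (wm a p) (eF Φm b p) = if a = b then (1:ℝ) else 0)
    -- identification of the riggings
    (hℓnorm : ∀ p, gdot gp (Φp p) (ℓp p) (ℓp p) = gdot gm (Φm p) (ℓm p) (ℓm p))
    (hℓe : ∀ p a, gdot gp (Φp p) (ℓp p) (eF Φp a p) = gdot gm (Φm p) (ℓm p) (eF Φm a p))
    -- junction conditions: equal generalized second fundamental forms
    (hH : ∀ p a b, Hgen gp ginvp Φp ℓp a b p = Hgen gm ginvm Φm ℓm a b p)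
    -- generators Φ^±-related to the common vector fields γ₁, γ₂ on σ
    (hrelξp : ∀ p, fderiv ℝ Φp p (γ₁ p) = ξp (Φp p))
    (hrelξm : ∀ p, fderiv ℝ Φm p (γ₁ p) = ξm (Φm p))
    (hrelηp : ∀ p, fderiv ℝ Φp p (γ₂ p) = ηp (Φp p))
    (hrelηm : ∀ p, fderiv ℝ Φm p (γ₂ p) = ηm (Φm p))
    -- the generators are conformal Killing fields on both sides
    (hconfξp : ∀ x a b, lieD gp ξp x a b = αξp x * gp x a b)
    (hconfξm : ∀ x a b, lieD gm ξm x a b = αξm x * gm x a b)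
    (hconfηp : ∀ x a b, lieD gp ηp x a b = αηp x * gp x a b)
    (hconfηm : ∀ x a b, lieD gm ηm x a b = αηm x * gm x a b)
    -- orthogonal transitivity on the (+) side, on a region W⁺ containing Σ⁺
    (W : Set (Pt (d+1))) (hW : Set.range Φp ⊆ W)
    (hOTη : ∀ x ∈ W, ∀ u : Fin 4 → Pt (d+1), form4 gp ξp ηp x u = 0)
    (hOTξ : ∀ x ∈ W, ∀ u : Fin 4 → Pt (d+1), form4 gp ηp ξp x u = 0) :
    ∀ p (u : Fin 4 → Pt (d+1)),
      form4 gm ξm ηm (Φm p) u = 0 ∧ form4 gm ηm ξm (Φm p) u = 0 := by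
  intro p u
  have hcomp₂ : ∀ {g : Pt (d+1) → Fin (d+1) → Fin (d+1) → ℝ},
      (∀ a b, ContDiff ℝ (⊤ : ℕ∞) fun x => g x a b) →
      ∀ a b, Differentiable ℝ fun x => g x a b := fun h a b => (h a b).differentiable (by simp)
  have hcomp : ∀ {n m : ℕ} {f : Pt n → Pt m}, ContDiff ℝ (⊤ : ℕ∞) f →
      ∀ a, Differentiable ℝ fun x => f x a := fun h =>
    differentiable_pi.mp (h.differentiable (by simp))
  have hexp := eq_sum_coframe hnℓm hnem hwℓm hwem p
  have hξ := ip_flat_frameV_eq hmatch hℓe hrelξp hrelξm p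
  have hη := ip_flat_frameV_eq hmatch hℓe hrelηp hrelηm p
  by_cases hne : ∃ a b, pull2 Φm gm p a b ≠ 0
  · let T : Pt (d+1) → Pt (d+1) :=
      fun v μ => ∑ i, ip (coframe nm wm p i) v * frameV Φp ℓp p i μ
    have hip : ∀ {ω ω' : Fin (d+1) → ℝ},
        (∀ i, ip ω (frameV Φm ℓm p i) = ip ω' (frameV Φp ℓp p i)) →
        ∀ v, ip ω v = ip ω' (T v) := by
      intro ω ω' h v
      conv_lhs => rw [hexp v]
      simp only [T, ip_sum_right, h]
    have hdext : ∀ {ω ω' : Pt (d+1) → Fin (d+1) → ℝ},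
        (∀ i j, dext ω (Φm p) (frameV Φm ℓm p i) (frameV Φm ℓm p j) =
          dext ω' (Φp p) (frameV Φp ℓp p i) (frameV Φp ℓp p j)) →
        ∀ v w, dext ω (Φm p) v w = dext ω' (Φp p) (T v) (T w) := by
      intro ω ω' h v w
      conv_lhs => rw [hexp v, hexp w]
      simp only [T, dext_sum_left, dext_sum_right, h]
    have hdξ := dext_flat_frameV_eq (hcomp₂ hgp) (hcomp₂ hgm) hgpsymm hgmsymm hinvp hinvm hΦp hΦm
      (hcomp hℓp) (hcomp hℓm) (hcomp hξp) (hcomp hξm) (hcomp hγ₁) hmatch hℓe hH hrelξp hrelξm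
      hconfξp hconfξm hne
    have hdη := dext_flat_frameV_eq (hcomp₂ hgp) (hcomp₂ hgm) hgpsymm hgmsymm hinvp hinvm hΦp hΦm
      (hcomp hℓp) (hcomp hℓm) (hcomp hηp) (hcomp hηm) (hcomp hγ₂) hmatch hℓe hH hrelηp hrelηm
      hconfηp hconfηm hne
    have hpW : Φp p ∈ W := hW (Set.mem_range_self p)
    exact ⟨(form4_eq_of_map T (hip hξ) (hip hη) (hdext hdη) u).trans (hOTη _ hpW _),
      (form4_eq_of_map T (hip hη) (hip hξ) (hdext hdξ) u).trans (hOTξ _ hpW _)⟩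
  · push Not at hne
    have hprop : ∀ {ζ : Pt (d+1) → Pt (d+1)} {γ : Pt d → Pt d},
        (∀ p, fderiv ℝ Φm p (γ p) = ζ (Φm p)) →
        ∀ v, ip (flat gm ζ (Φm p)) v = ip (flat gm ζ (Φm p)) (ℓm p) * ip (nm p) v := by
      intro ζ γ hrel v
      have he : ∀ a, ip (flat gm ζ (Φm p)) (eF Φm a p) = 0 := by
        intro a
        simp [ip_flat_eq_sum hrel, gdot_eF, hne]
      conv_lhs => rw [hexp v]
      rw [ip_sum_right, Fintype.sum_option]
      simp [frameV, coframe, he, mul_comm]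
    exact ⟨form4_eq_zero_of_proportional _ _ _ (hprop hrelξm) (hprop hrelηm) u,
      form4_eq_zero_of_proportional _ _ _ (hprop hrelηm) (hprop hrelξm) u⟩
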